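/- Let (X, T) and (Y, S) be dynamical systems with metrics d on X and d' on Y, and let π : (X, T) → (Y, S) be an equivariant continuous map. Then the lower conditional metric mean dimension satisfies lower-mdim_M(π, T, d) = liminf_{ε→0} { lim_{δ→0} ( lim_{N→∞} (sup_{y∈Y} log #(π^{-1}(B_δ(y, d'_N)), d_N, ε)) / (N log(1/ε)) ) }, where B_δ(y, d'_N) = {x ∈ Y : d'_N(x, y) ≤ δ}. -/

import Mathlib

open Filter Topology
open scoped ENNReal NNReal

noncomputable section

/-- Diameter (in `ℝ≥0∞`) of a set with respect to a distance function `ρ`. -/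
def setEDiam {X : Type*} (ρ : X → X → ℝ) (E : Set X) : ℝ≥0∞ :=
  ⨆ x ∈ E, ⨆ y ∈ E, ENNReal.ofReal (ρ x y)

/-- Openness with respect to a distance function `ρ`. -/
def ROpen {X : Type*} (ρ : X → X → ℝ) (U : Set X) : Prop :=
  ∀ x ∈ U, ∃ δ > 0, ∀ y, ρ x y < δ → y ∈ U

/-- `#(E, ρ, ε)`: the minimal number `n` of `ρ`-open sets of `ρ`-diameter `< ε` covering `E`
(`0` when `E = ∅`, since the empty family covers it). -/
def covNum {X : Type*} (ρ : X → X → ℝ) (ε : ℝ) (E : Set X) : ℕ :=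
  sInf {n : ℕ | ∃ U : Fin n → Set X, (∀ i, ROpen ρ (U i)) ∧
    (∀ i, setEDiam ρ (U i) < ENNReal.ofReal ε) ∧ E ⊆ ⋃ i, U i}

/-- The dynamical metric `d_N(x,y) = max_{0 ≤ n < N} d(Tⁿx, Tⁿy)`. -/
def dynDist {X : Type*} (T : X → X) (d : X → X → ℝ) (N : ℕ) (x y : X) : ℝ :=
  sSup {r : ℝ | ∃ n, n < N ∧ r = d (T^[n] x) (T^[n] y)}

/-- `sup_{y ∈ Y} log #(π⁻¹(y), ρ, ε)`. -/
def supLogCov {X Y : Type*} (π : X → Y) (ρ : X → X → ℝ) (ε : ℝ) : ℝ :=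
  ⨆ y : Y, Real.log (covNum ρ ε (π ⁻¹' {y}) : ℝ)

/-- `sup_{y ∈ Y} log #(π⁻¹(B_δ(y, ρY)), ρX, ε)` where `B_δ` is the closed `δ`-ball. -/
def supLogCovBall {X Y : Type*} (π : X → Y) (ρX : X → X → ℝ) (ρY : Y → Y → ℝ)
    (ε δ : ℝ) : ℝ :=
  ⨆ y : Y, Real.log (covNum ρX ε (π ⁻¹' {x | ρY x y ≤ δ}) : ℝ)

/-- Topological conditional entropy
`h_top(π, T) = lim_{ε→0} lim_{N→∞} (sup_y log #(π⁻¹(y), d_N, ε))/N`, as an extended real. -/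
def condEntropy {X Y : Type*} (π : X → Y) (T : X → X) (d : X → X → ℝ) : EReal :=
  Filter.limsup (fun ε : ℝ => Filter.liminf
      (fun N : ℕ => ((supLogCov π (dynDist T d N) ε / N : ℝ) : EReal)) Filter.atTop)
    (𝓝[>] (0 : ℝ))

/-- `lim_{N→∞} (sup_y log #(π⁻¹(y), d_N, ε))/(N log(1/ε))` (the limit exists by
subadditivity; it is realized here as a liminf). -/
def condMdimRate {X Y : Type*} (π : X → Y) (T : X → X) (d : X → X → ℝ) (ε : ℝ) : EReal :=
  Filter.liminf (fun N : ℕ =>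
    ((supLogCov π (dynDist T d N) ε / (N * Real.log (1 / ε)) : ℝ) : EReal)) Filter.atTop

/-- Lower conditional metric mean dimension of `π : (X,T,d) → Y`. -/
def lowerCondMdimM {X Y : Type*} (π : X → Y) (T : X → X) (d : X → X → ℝ) : EReal :=
  Filter.liminf (fun ε : ℝ => condMdimRate π T d ε) (𝓝[>] (0 : ℝ))

/-- Upper conditional metric mean dimension of `π : (X,T,d) → Y`. -/
def upperCondMdimM {X Y : Type*} (π : X → Y) (T : X → X) (d : X → X → ℝ) : EReal :=
  Filter.limsup (fun ε : ℝ => condMdimRate π T d ε) (𝓝[>] (0 : ℝ))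

/-- `lim_{N→∞} log #(X, d_N, ε)/(N log(1/ε))`. -/
def mdimMRate {X : Type*} (T : X → X) (d : X → X → ℝ) (ε : ℝ) : EReal :=
  Filter.liminf (fun N : ℕ =>
    ((Real.log (covNum (dynDist T d N) ε (Set.univ : Set X) : ℝ) /
      (N * Real.log (1 / ε)) : ℝ) : EReal)) Filter.atTop

/-- Lower metric mean dimension of `(X, T, d)`. -/
def lowerMdimM {X : Type*} (T : X → X) (d : X → X → ℝ) : EReal :=
  Filter.liminf (fun ε : ℝ => mdimMRate T d ε) (𝓝[>] (0 : ℝ))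

/-- Upper metric mean dimension of `(X, T, d)`. -/
def upperMdimM {X : Type*} (T : X → X) (d : X → X → ℝ) : EReal :=
  Filter.limsup (fun ε : ℝ => mdimMRate T d ε) (𝓝[>] (0 : ℝ))

/-- `widim_ε(X, ρ)`: the minimal `k` such that there are a finite simplicial complex of
dimension `≤ k` (realized in some `ℝ^m`) and a continuous `ε`-embedding `f : X → P`
(all fibers of `f` have `ρ`-diameter `< ε`). -/
def widim (X : Type*) [TopologicalSpace X] (ρ : X → X → ℝ) (ε : ℝ) : ℕ :=
  sInf {k : ℕ | ∃ (m : ℕ) (K : Geometry.SimplicialComplex ℝ (Fin m → ℝ)),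
    K.faces.Finite ∧ (∀ s ∈ K.faces, s.card ≤ k + 1) ∧
    ∃ f : X → K.space, Continuous f ∧
      ∀ p : K.space, setEDiam ρ (f ⁻¹' {p}) < ENNReal.ofReal ε}

/-- Mean dimension `mdim(X, T) = lim_{ε→0} lim_{N→∞} widim_ε(X, d_N)/N`. -/
def mdim (X : Type*) [TopologicalSpace X] (T : X → X) (d : X → X → ℝ) : EReal :=
  Filter.limsup (fun ε : ℝ => Filter.liminf
      (fun N : ℕ => (((widim X (dynDist T d N) ε : ℝ) / N : ℝ) : EReal)) Filter.atTop)
    (𝓝[>] (0 : ℝ))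

/-- The cube `[0,1]^a`. -/
abbrev Cube (a : ℕ) := Fin a → unitInterval

/-- The full shift space `([0,1]^a)^ℤ`. -/
abbrev FullShift (a : ℕ) := ℤ → Cube a

/-- The shift map `σ((x_n)_n) = (x_{n+1})_n`. -/
def shift {α : Type*} (x : ℤ → α) : ℤ → α := fun n => x (n + 1)

/-- The `ℓ^∞`-distance on the cube `[0,1]^a`. -/
def cubeDist {a : ℕ} (x y : Cube a) : ℝ :=
  ‖(fun i => (x i : ℝ)) - fun i => (y i : ℝ)‖

/-- The metric `D((x_n), (y_n)) = Σ_{n∈ℤ} 2^{-|n|} ‖x_n − y_n‖_∞` on the full shift. -/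
def shiftDist {a : ℕ} (x y : FullShift a) : ℝ :=
  ∑' n : ℤ, (2 : ℝ) ^ (-|n|) * cubeDist (x n) (y n)

end

section Auxiliary

variable {X Y : Type*}

lemma dynDist_le {T : X → X} {d : X → X → ℝ} {N : ℕ} {x y : X} {r : ℝ} (hr : 0 ≤ r)
    (h : ∀ n < N, d (T^[n] x) (T^[n] y) ≤ r) : dynDist T d N x y ≤ r := by
  refine Real.sSup_le ?_ hr
  rintro _ ⟨n, hn, rfl⟩
  exact h n hn

lemma le_dynDist (T : X → X) (d : X → X → ℝ) {N n : ℕ} (hn : n < N) (x y : X) :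
    d (T^[n] x) (T^[n] y) ≤ dynDist T d N x y := by
  refine le_csSup (Set.Finite.bddAbove ?_) ⟨n, hn, rfl⟩
  refine ((Finset.range N).finite_toSet.image fun n => d (T^[n] x) (T^[n] y)).subset ?_
  rintro _ ⟨m, hm, rfl⟩
  exact ⟨m, by simpa using hm, rfl⟩

lemma ofReal_le_setEDiam {ρ : X → X → ℝ} {E : Set X} {x y : X} (hx : x ∈ E) (hy : y ∈ E) :
    ENNReal.ofReal (ρ x y) ≤ setEDiam ρ E :=
  le_iSup₂_of_le x hx (le_iSup₂_of_le y hy le_rfl)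

lemma IsOpen.rOpen_dynDist [PseudoMetricSpace X] {U : Set X} (hU : IsOpen U) (T : X → X)
    {N : ℕ} (hN : 0 < N) : ROpen (dynDist T dist N) U := by
  intro x hx
  obtain ⟨δ, hδ, h⟩ := Metric.isOpen_iff.1 hU x hx
  refine ⟨δ, hδ, fun y hy => h ?_⟩
  rw [Metric.mem_ball, dist_comm]
  exact (le_dynDist T dist hN x y).trans_lt hy

lemma eventually_dynDist_lt [PseudoMetricSpace X] {T : X → X} (hT : Continuous T) (N : ℕ) (x : X)
    {δ : ℝ} (hδ : 0 < δ) : ∀ᶠ y in 𝓝 x, dynDist T dist N x y < δ := by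
  have h : ∀ᶠ y in 𝓝 x, ∀ n ∈ Finset.range N, dist (T^[n] x) (T^[n] y) < δ / 2 := by
    rw [Finset.eventually_all]
    intro n _
    have hc : Continuous fun y => dist (T^[n] x) (T^[n] y) :=
      continuous_const.dist (hT.iterate n)
    refine hc.continuousAt.eventually_lt continuousAt_const ?_
    simpa using half_pos hδ
  filter_upwards [h] with y hy
  exact (dynDist_le (half_pos hδ).le fun n hn => (hy n (by simpa using hn)).le).trans_lt
    (half_lt_self hδ)

lemma ROpen.isOpen_of_dynDist [PseudoMetricSpace X] {T : X → X} (hT : Continuous T) {N : ℕ}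
    {U : Set X} (hU : ROpen (dynDist T dist N) U) : IsOpen U := by
  rw [isOpen_iff_mem_nhds]
  intro x hx
  obtain ⟨δ, hδ, h⟩ := hU x hx
  exact (eventually_dynDist_lt hT N x hδ).mono h

lemma covNum_le_card {ρ : X → X → ℝ} {ε : ℝ} {E : Set X} {ι : Type*} [Fintype ι]
    (U : ι → Set X) (ho : ∀ i, ROpen ρ (U i)) (hd : ∀ i, setEDiam ρ (U i) < ENNReal.ofReal ε)
    (hE : E ⊆ ⋃ i, U i) : covNum ρ ε E ≤ Fintype.card ι := by
  refine Nat.sInf_le ⟨fun i => U ((Fintype.equivFin ι).symm i), fun i => ho _, fun i => hd _, ?_⟩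
  intro x hx
  obtain ⟨i, hi⟩ := Set.mem_iUnion.1 (hE hx)
  exact Set.mem_iUnion.2 ⟨Fintype.equivFin ι i, by simpa using hi⟩

lemma exists_finite_cover [PseudoMetricSpace X] [CompactSpace X] {T : X → X} (hT : Continuous T)
    {N : ℕ} (hN : 0 < N) {ε : ℝ} (hε : 0 < ε) :
    ∃ (n : ℕ) (U : Fin n → Set X), (∀ i, ROpen (dynDist T dist N) (U i)) ∧
      (∀ i, setEDiam (dynDist T dist N) (U i) < ENNReal.ofReal ε) ∧ Set.univ ⊆ ⋃ i, U i := by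
  set r : ℝ := ε / 4
  have hr : 0 < r := by positivity
  set V : X → Set X := fun x => {y | ∀ n < N, dist (T^[n] y) (T^[n] x) < r} with hV
  have hVo : ∀ x, IsOpen (V x) := by
    intro x
    have : V x = ⋂ n ∈ Finset.range N, {y | dist (T^[n] y) (T^[n] x) < r} := by
      ext y; simp [hV]
    rw [this]
    exact isOpen_biInter_finset fun n _ =>
      isOpen_lt ((hT.iterate n).dist continuous_const) continuous_const
  obtain ⟨t, ht⟩ := isCompact_univ.elim_finite_subcover V hVo
    fun x _ => Set.mem_iUnion.2 ⟨x, fun n _ => by simpa using hr⟩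
  refine ⟨t.card, fun i => V (t.equivFin.symm i), fun i => (hVo _).rOpen_dynDist T hN,
    fun i => ?_, ?_⟩
  · refine lt_of_le_of_lt (b := ENNReal.ofReal (2 * r)) ?_ ?_
    · refine iSup₂_le fun x hx => iSup₂_le fun y hy => ENNReal.ofReal_le_ofReal ?_
      refine dynDist_le (by positivity) fun n hn => ?_
      have h := dist_triangle_right (T^[n] x) (T^[n] y) (T^[n] (t.equivFin.symm i : X))
      linarith [hx n hn, hy n hn]
    · rw [ENNReal.ofReal_lt_ofReal_iff hε]
      simp only [r]; linarith
  · intro x hx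
    obtain ⟨z, hz, hxz⟩ := Set.mem_iUnion₂.1 (ht hx)
    exact Set.mem_iUnion.2 ⟨t.equivFin ⟨z, hz⟩, by simpa using hxz⟩

lemma exists_cover_covNum [PseudoMetricSpace X] [CompactSpace X] {T : X → X} (hT : Continuous T)
    {N : ℕ} (hN : 0 < N) {ε : ℝ} (hε : 0 < ε) (E : Set X) :
    ∃ U : Fin (covNum (dynDist T dist N) ε E) → Set X,
      (∀ i, ROpen (dynDist T dist N) (U i)) ∧
      (∀ i, setEDiam (dynDist T dist N) (U i) < ENNReal.ofReal ε) ∧ E ⊆ ⋃ i, U i := by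
  obtain ⟨n, U, h₁, h₂, h₃⟩ := exists_finite_cover (T := T) hT hN hε
  exact Nat.sInf_mem (s := {n : ℕ | ∃ U : Fin n → Set X, (∀ i, ROpen (dynDist T dist N) (U i)) ∧
    (∀ i, setEDiam (dynDist T dist N) (U i) < ENNReal.ofReal ε) ∧ E ⊆ ⋃ i, U i})
    ⟨n, U, h₁, h₂, (Set.subset_univ E).trans h₃⟩

lemma covNum_mono [PseudoMetricSpace X] [CompactSpace X] {T : X → X} (hT : Continuous T)
    {N : ℕ} (hN : 0 < N) {ε : ℝ} (hε : 0 < ε) {E F : Set X} (hEF : E ⊆ F) :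
    covNum (dynDist T dist N) ε E ≤ covNum (dynDist T dist N) ε F := by
  obtain ⟨U, h₁, h₂, h₃⟩ := exists_cover_covNum (T := T) hT hN hε F
  simpa using covNum_le_card U h₁ h₂ (hEF.trans h₃)

lemma log_natCast_le_log_natCast {m n : ℕ} (h : m ≤ n) : Real.log m ≤ Real.log n := by
  rcases Nat.eq_zero_or_pos m with rfl | hm
  · simpa using Real.log_natCast_nonneg n
  · exact Real.log_le_log (by exact_mod_cast hm) (by exact_mod_cast h)

lemma bddAbove_range_log_covNum [PseudoMetricSpace X] [CompactSpace X] {T : X → X}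
    (hT : Continuous T) {N : ℕ} (hN : 0 < N) {ε : ℝ} (hε : 0 < ε) (E : Y → Set X) :
    BddAbove (Set.range fun y => Real.log (covNum (dynDist T dist N) ε (E y) : ℝ)) := by
  refine ⟨Real.log (covNum (dynDist T dist N) ε (Set.univ : Set X) : ℝ), ?_⟩
  rintro _ ⟨y, rfl⟩
  exact log_natCast_le_log_natCast (covNum_mono hT hN hε (Set.subset_univ _))

lemma supLogCov_nonneg (π : X → Y) (ρ : X → X → ℝ) (ε : ℝ) : 0 ≤ supLogCov π ρ ε :=
  Real.iSup_nonneg fun _ => Real.log_natCast_nonneg _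

lemma supLogCov_le_supLogCovBall [PseudoMetricSpace X] [CompactSpace X] [PseudoMetricSpace Y]
    {T : X → X} (hT : Continuous T) (S : Y → Y) (π : X → Y) {N : ℕ} (hN : 0 < N)
    {ε δ : ℝ} (hε : 0 < ε) (hδ : 0 ≤ δ) :
    supLogCov π (dynDist T dist N) ε ≤
      supLogCovBall π (dynDist T dist N) (dynDist S dist N) ε δ := by
  refine ciSup_mono (bddAbove_range_log_covNum hT hN hε _) fun y =>
    log_natCast_le_log_natCast (covNum_mono hT hN hε (Set.preimage_mono ?_))
  rintro _ rfl
  exact dynDist_le hδ fun n _ => by simpa using hδ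

/-- Covers along `q` consecutive time blocks of length `M` can be joined into a cover for any
time `N ≤ q * M`. -/
lemma covNum_le_prod [PseudoMetricSpace X] {T : X → X} (hT : Continuous T) {M N q : ℕ}
    (hM : 0 < M) (hN : 0 < N) (hNq : N ≤ q * M) {ε : ℝ} (hε : 0 < ε) {E : Set X} (n : Fin q → ℕ)
    (U : ∀ k, Fin (n k) → Set X) (ho : ∀ k i, IsOpen (U k i))
    (hd : ∀ k i, setEDiam (dynDist T dist M) (U k i) < ENNReal.ofReal ε)
    (hE : ∀ x ∈ E, ∀ k : Fin q, T^[(k : ℕ) * M] x ∈ ⋃ i, U k i) :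
    covNum (dynDist T dist N) ε E ≤ ∏ k, n k := by
  have hcard : Fintype.card (∀ k, Fin (n k)) = ∏ k, n k := by simp
  rw [← hcard]
  refine covNum_le_card (fun f : ∀ k, Fin (n k) => ⋂ k : Fin q, T^[(k : ℕ) * M] ⁻¹' U k (f k))
    (fun f => ?_) (fun f => ?_) fun x hx => ?_
  · exact (isOpen_iInter_of_finite fun k =>
      (ho k (f k)).preimage (hT.iterate _)).rOpen_dynDist T hN
  · set c := Finset.univ.sup fun k => setEDiam (dynDist T dist M) (U k (f k))
    have hcε : c < ENNReal.ofReal ε :=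
      (Finset.sup_lt_iff (by simpa using hε)).2 fun k _ => hd k (f k)
    have hctop : c ≠ ⊤ := (hcε.trans ENNReal.ofReal_lt_top).ne
    refine lt_of_le_of_lt (iSup₂_le fun x hx => iSup₂_le fun y hy => ?_) hcε
    rw [ENNReal.ofReal_le_iff_le_toReal hctop]
    refine dynDist_le ENNReal.toReal_nonneg fun m hm => ?_
    have hk : m / M < q := (Nat.div_lt_iff_lt_mul hM).2 (hm.trans_le hNq)
    have hsplit : ∀ z, T^[m] z = T^[m % M] (T^[m / M * M] z) := fun z => by
      rw [← Function.iterate_add_apply, Nat.mod_add_div']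
    rw [hsplit x, hsplit y]
    refine (le_dynDist T dist (Nat.mod_lt m hM) _ _).trans ?_
    rw [← ENNReal.ofReal_le_iff_le_toReal hctop]
    have hx' : T^[m / M * M] x ∈ U ⟨m / M, hk⟩ (f ⟨m / M, hk⟩) := Set.mem_iInter.1 hx ⟨m / M, hk⟩
    have hy' : T^[m / M * M] y ∈ U ⟨m / M, hk⟩ (f ⟨m / M, hk⟩) := Set.mem_iInter.1 hy ⟨m / M, hk⟩
    exact (ofReal_le_setEDiam hx' hy').trans
      (Finset.le_sup (f := fun k => setEDiam (dynDist T dist M) (U k (f k)))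
        (Finset.mem_univ (⟨m / M, hk⟩ : Fin q)))
  · choose f hf using fun k => Set.mem_iUnion.1 (hE x hx k)
    exact Set.mem_iUnion.2 ⟨f, Set.mem_iInter.2 hf⟩

lemma exists_supLogCovBall_le [PseudoMetricSpace X] [CompactSpace X] [MetricSpace Y]
    [CompactSpace Y] {T : X → X} (hT : Continuous T) {S : Y → Y} {π : X → Y} (hπ : Continuous π)
    (h : Function.Semiconj π T S) {M : ℕ} (hM : 0 < M) {ε : ℝ} (hε : 0 < ε) :
    ∃ δ₀ > 0, ∀ δ < δ₀, ∀ N > 0,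
      supLogCovBall π (dynDist T dist N) (dynDist S dist N) ε δ ≤
        ((N : ℝ) / M + 1) * supLogCov π (dynDist T dist M) ε := by
  set a := supLogCov π (dynDist T dist M) ε
  have ha0 : 0 ≤ a := supLogCov_nonneg _ _ _
  set n : Y → ℕ := fun y => covNum (dynDist T dist M) ε (π ⁻¹' {y})
  have hna : ∀ y, (n y : ℝ) ≤ Real.exp a := by
    intro y
    rcases Nat.eq_zero_or_pos (n y) with h0 | h0
    · rw [h0]; simpa using (Real.exp_pos a).le
    · rw [← Real.log_le_iff_le_exp (by exact_mod_cast h0)]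
      exact le_ciSup (bddAbove_range_log_covNum hT hM hε fun y => π ⁻¹' {y}) y
  choose U hUo hUd hUc using fun y => exists_cover_covNum (T := T) hT hM hε (π ⁻¹' {y})
  have hUopen : ∀ y i, IsOpen (U y i) := fun y i => (hUo y i).isOpen_of_dynDist hT
  set V : Y → Set Y := fun y => (π '' (⋃ i, U y i)ᶜ)ᶜ
  have hVo : ∀ y, IsOpen (V y) := fun y =>
    (hπ.isClosedMap _ (isOpen_iUnion (hUopen y)).isClosed_compl).isOpen_compl
  have hVmem : ∀ y, y ∈ V y := by
    rintro y ⟨x, hx, hxy⟩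
    exact hx (hUc y hxy)
  have hVsub : ∀ y x, π x ∈ V y → x ∈ ⋃ i, U y i := by
    intro y x hx
    by_contra hc
    exact hx ⟨x, hc, rfl⟩
  obtain ⟨δ₀, hδ₀, hleb⟩ := lebesgue_number_lemma_of_metric isCompact_univ hVo
    fun y _ => Set.mem_iUnion.2 ⟨y, hVmem y⟩
  choose! c hc using hleb
  refine ⟨δ₀, hδ₀, fun δ hδ N hN => ?_⟩
  set q := (N - 1) / M + 1 with hq
  have hNq : N ≤ q * M := by
    have := Nat.lt_div_mul_add (a := N - 1) hM
    rw [hq, add_mul, one_mul]; omega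
  have hqN : (q : ℝ) ≤ N / M + 1 := by
    rw [hq]; push_cast
    have h₁ : (((N - 1) / M : ℕ) : ℝ) ≤ ((N - 1 : ℕ) : ℝ) / M := Nat.cast_div_le
    have h₂ : ((N - 1 : ℕ) : ℝ) / M ≤ N / M := by gcongr; omega
    linarith
  refine (Real.iSup_le (fun y => ?_) (by positivity)).trans
    (mul_le_mul_of_nonneg_right hqN ha0)
  have hcov := covNum_le_prod hT hM hN hNq hε (E := π ⁻¹' {x | dynDist S dist N x y ≤ δ})
    (fun k : Fin q => n (c (S^[k * M] y))) (fun k => U (c (S^[k * M] y)))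
    (fun k => hUopen _) (fun k => hUd _) (by
      intro x hx k
      refine hVsub _ _ (hc _ (Set.mem_univ _) ?_)
      have hkN : (k : ℕ) * M < N := by
        have h₁ : (k : ℕ) ≤ (N - 1) / M := Nat.lt_succ_iff.1 k.2
        have h₂ := (Nat.mul_le_mul_right M h₁).trans (Nat.div_mul_le_self (N - 1) M)
        omega
      rw [(h.iterate_right _).eq, Metric.mem_ball]
      exact ((le_dynDist S dist hkN _ _).trans hx).trans_lt hδ)
  refine (log_natCast_le_log_natCast hcov).trans ?_
  rcases Nat.eq_zero_or_pos (∏ k : Fin q, n (c (S^[k * M] y))) with h0 | h0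
  · rw [h0]; simp only [Nat.cast_zero, Real.log_zero]; positivity
  · rw [Real.log_le_iff_le_exp (by exact_mod_cast h0), Nat.cast_prod, Real.exp_nat_mul]
    refine (Finset.prod_le_prod (fun _ _ => Nat.cast_nonneg _) fun k _ => hna _).trans ?_
    simp

end Auxiliary

/-- the lower conditional metric mean dimension equals
`liminf_{ε→0} lim_{δ→0} lim_{N→∞} (sup_y log #(π⁻¹(B_δ(y, d'_N)), d_N, ε))/(N log(1/ε))`. -/
theorem stmt_14 (X Y : Type) [MetricSpace X] [CompactSpace X]
    [MetricSpace Y] [CompactSpace Y] (T : X ≃ₜ X) (S : Y ≃ₜ Y)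
    (π : X → Y) (hcont : Continuous π) (hequiv : ∀ x, π (T x) = S (π x)) :
    lowerCondMdimM π (⇑T) dist =
      Filter.liminf (fun ε : ℝ =>
        Filter.liminf (fun δ : ℝ =>
          Filter.liminf (fun N : ℕ =>
            ((supLogCovBall π (dynDist (⇑T) dist N) (dynDist (⇑S) dist N) ε δ /
                (N * Real.log (1 / ε)) : ℝ) : EReal)) Filter.atTop)
          (𝓝[>] (0 : ℝ)))
        (𝓝[>] (0 : ℝ)) := by
  refine liminf_congr ?_
  filter_upwards [Ioo_mem_nhdsGT (zero_lt_one' ℝ)] with ε hε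
  have hL : 0 < Real.log (1 / ε) := Real.log_pos (by rw [lt_div_iff₀ hε.1]; linarith [hε.2])
  have hT : Continuous T := T.continuous
  refine le_antisymm ?_ ?_
  · refine le_liminf_of_le (by isBoundedDefault) ?_
    filter_upwards [self_mem_nhdsWithin] with δ hδ
    refine liminf_le_liminf ?_
    filter_upwards [eventually_gt_atTop 0] with N hN
    have := supLogCov_le_supLogCovBall hT S π hN hε.1 (le_of_lt hδ)
    rw [EReal.coe_le_coe_iff]
    gcongr
  · refine le_liminf_of_le (by isBoundedDefault) ?_
    filter_upwards [eventually_gt_atTop 0] with M hM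
    obtain ⟨δ₀, hδ₀, hle⟩ := exists_supLogCovBall_le (S := S) hT hcont hequiv hM hε.1
    set a := supLogCov π (dynDist T dist M) ε
    set L := Real.log (1 / ε)
    refine liminf_le_of_frequently_le' (Eventually.frequently ?_)
    filter_upwards [Ioo_mem_nhdsGT hδ₀] with δ hδ
    have hlim : Tendsto (fun N : ℕ => ((a / (M * L) + a / L / N : ℝ) : EReal)) atTop
        (𝓝 ((a / (M * L) : ℝ) : EReal)) := by
      rw [EReal.tendsto_coe]
      simpa using (tendsto_const_div_atTop_nhds_zero_nat (a / L)).const_add (a / (M * L))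
    rw [← hlim.liminf_eq]
    refine liminf_le_liminf ?_
    filter_upwards [eventually_gt_atTop 0] with N hN
    rw [EReal.coe_le_coe_iff, div_le_iff₀ (by positivity)]
    refine (hle δ hδ.2 N hN).trans_eq ?_
    field_simp
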